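/- Let Γ be a countable group and let f : Γ → ℤ be finitely supported. Suppose f is invertible in ℓ¹(Γ): there exists g : Γ → ℝ with Σ_{s∈Γ} |g(s)| < ∞ such that the convolutions f⋆g and g⋆f both equal the indicator function of the identity element, where (f⋆g)(u) = Σ_{h∈Γ} f(h)·g(h⁻¹u). Define the principal algebraic action: X_f = {x : Γ → ℝ/ℤ : Σ_{s∈Γ} f(s)·x(hs) = 0 in ℝ/ℤ for every h ∈ Γ}, a closed shift-invariant subset of the compact metrizable space (ℝ/ℤ)^Γ with shift action (γ·x)(h) = x(γ⁻¹h). Then, for any metric on X_f compatible with the product topology, the shift action of Γ on X_f is expansive and satisfies the pseudo-orbit tracing property. -/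

import Mathlib

section ProductMetric

variable {ι E : Type*} [PseudoMetricSpace E] {X : Set (ι → E)}

theorem MetricSpace.toUniformSpace_eq_subtype_pi_of_isCompact (hX : IsCompact X)
    (dX : MetricSpace X)
    (hdX : dX.toUniformSpace.toTopologicalSpace = (inferInstance : TopologicalSpace X)) :
    dX.toUniformSpace = instUniformSpaceSubtype :=
  have := isCompact_iff_compactSpace.mp hX
  unique_uniformity_of_compact hdX rfl

theorem exists_finite_forall_dist_lt_of_isCompact (hX : IsCompact X) (dX : MetricSpace X)
    (hdX : dX.toUniformSpace.toTopologicalSpace = (inferInstance : TopologicalSpace X))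
    {ε : ℝ} (hε : 0 < ε) :
    ∃ I : Set ι, I.Finite ∧ ∃ η : ℝ, 0 < η ∧ ∀ x y : X,
      (∀ i ∈ I, dist (x.1 i) (y.1 i) < η) → dX.dist x y < ε := by
  have hu := dX.toUniformSpace_eq_subtype_pi_of_isCompact hX hdX
  have hmem := (@Metric.uniformity_basis_dist X dX.toPseudoMetricSpace).mem_of_mem hε
  rw [hu, uniformity_subtype, Pi.uniformity] at hmem
  obtain ⟨⟨I, η⟩, ⟨hI, hη⟩, hsub⟩ := ((Filter.HasBasis.iInf' fun i : ι =>
    (Metric.uniformity_basis_dist (α := E)).comap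
      fun a : (ι → E) × (ι → E) => (a.1 i, a.2 i)).comap _).mem_iff.mp hmem
  have hmin : ∀ᶠ r in nhdsWithin (0 : ℝ) (Set.Ioi 0), ∀ i ∈ I, r < η i :=
    (Filter.eventually_all_finite hI).mpr fun i hi =>
      Filter.Eventually.filter_mono nhdsWithin_le_nhds (eventually_lt_nhds (hη i hi))
  obtain ⟨r, hr, hr0⟩ := (hmin.and self_mem_nhdsWithin).exists
  refine ⟨I, hI, r, hr0, fun x y hxy => ?_⟩
  refine hsub (a := (x, y)) ?_
  simp only [Set.mem_preimage, Set.mem_iInter]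
  exact fun i hi => (hxy i hi).trans (hr i hi)

theorem exists_forall_dist_apply_lt_of_isCompact (hX : IsCompact X) (dX : MetricSpace X)
    (hdX : dX.toUniformSpace.toTopologicalSpace = (inferInstance : TopologicalSpace X))
    (i : ι) {η : ℝ} (hη : 0 < η) :
    ∃ δ : ℝ, 0 < δ ∧ ∀ x y : X, dX.dist x y < δ → dist (x.1 i) (y.1 i) < η := by
  have hu := dX.toUniformSpace_eq_subtype_pi_of_isCompact hX hdX
  have hcont : UniformContinuous fun x : X => x.1 i :=
    (Pi.uniformContinuous_proj _ i).comp uniformContinuous_subtype_val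
  have hmem := hcont (Metric.dist_mem_uniformity hη)
  rw [← hu] at hmem
  obtain ⟨δ, hδ, hsub⟩ :=
    (@Metric.uniformity_basis_dist X dX.toPseudoMetricSpace).mem_iff.mp hmem
  exact ⟨δ, hδ, fun x y hxy => hsub (a := (x, y)) hxy⟩

end ProductMetric

section Convolution

variable {Γ : Type*} [Group Γ]

theorem Summable.mul_of_abs_of_bounded {ι : Type*} {g e : ι → ℝ} (hg : Summable fun s => |g s|)
    {C : ℝ} (he : ∀ s, |e s| ≤ C) : Summable fun s => g s * e s :=
  .of_norm_bounded (hg.mul_right C) fun s => by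
    rw [Real.norm_eq_abs, abs_mul]
    exact mul_le_mul_of_nonneg_left (he s) (abs_nonneg _)

theorem abs_tsum_mul_le {ι : Type*} {g e : ι → ℝ} (hg : Summable fun s => |g s|)
    {C : ℝ} (he : ∀ s, |e s| ≤ C) : |∑' s, g s * e s| ≤ (∑' s, |g s|) * C := by
  rw [← tsum_mul_right, ← Real.norm_eq_abs]
  refine tsum_of_norm_bounded (hg.mul_right C).hasSum fun s => ?_
  rw [Real.norm_eq_abs, abs_mul]
  exact mul_le_mul_of_nonneg_left (he s) (abs_nonneg _)

open Classical in
theorem sum_mul_tsum_mul_eq_of_finsum_eq {f g : Γ → ℝ} {F : Finset Γ}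
    (hF : Function.support f ⊆ F) (hg : Summable fun s => |g s|)
    (hfg : ∀ u, ∑ᶠ h, f h * g (h⁻¹ * u) = if u = 1 then 1 else 0)
    {e : Γ → ℝ} {C : ℝ} (he : ∀ s, |e s| ≤ C) (h : Γ) :
    ∑ s ∈ F, f s * ∑' t, g t * e (h * s * t) = e h := by
  have hsum : ∀ s ∈ F, Summable fun u => f s * (g (s⁻¹ * u) * e (h * u)) := fun s _ => by
    have hgs : Summable fun u => |g (s⁻¹ * u)| := (Equiv.mulLeft s⁻¹).summable_iff.mpr hg
    exact (hgs.mul_of_abs_of_bounded fun u => he (h * u)).mul_left (f s)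
  calc ∑ s ∈ F, f s * ∑' t, g t * e (h * s * t)
      = ∑ s ∈ F, ∑' u, f s * (g (s⁻¹ * u) * e (h * u)) := by
        refine Finset.sum_congr rfl fun s _ => ?_
        rw [tsum_mul_left, ← (Equiv.mulLeft s⁻¹).tsum_eq fun t => g t * e (h * s * t)]
        simp [mul_assoc]
    _ = ∑' u, ∑ s ∈ F, f s * (g (s⁻¹ * u) * e (h * u)) := (Summable.tsum_finsetSum hsum).symm
    _ = ∑' u, if u = 1 then e (h * u) else 0 := by
        refine tsum_congr fun u => ?_
        have := hfg u
        rw [finsum_eq_sum_of_support_subset (s := F) _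
          fun s hs => hF (left_ne_zero_of_mul hs)] at this
        simp only [← mul_assoc, ← Finset.sum_mul, this, ite_mul, one_mul, zero_mul]
    _ = e h := by rw [tsum_ite_eq, mul_one]

open Classical in
theorem tsum_mul_sum_mul_eq_of_finsum_eq {f g : Γ → ℝ} {F : Finset Γ}
    (hF : Function.support f ⊆ F) (hg : Summable fun s => |g s|)
    (hgf : ∀ u, ∑ᶠ h, g h * f (h⁻¹ * u) = if u = 1 then 1 else 0)
    {e : Γ → ℝ} {C : ℝ} (he : ∀ s, |e s| ≤ C) (h : Γ) :
    ∑' t, g t * ∑ s ∈ F, f s * e (h * t * s) = e h := by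
  have hsum₁ : ∀ s ∈ F, Summable fun t => g t * (f s * e (h * t * s)) := fun s _ => by
    refine Summable.mul_of_abs_of_bounded (C := |f s| * C) hg fun t => ?_
    rw [abs_mul]
    exact mul_le_mul_of_nonneg_left (he _) (abs_nonneg _)
  have hsum₂ : ∀ s ∈ F, Summable fun u => g (u * s⁻¹) * (f s * e (h * u)) := fun s hs => by
    refine (Equiv.mulRight s).summable_iff.mp ((hsum₁ s hs).congr fun t => ?_)
    simp [mul_assoc]
  calc ∑' t, g t * ∑ s ∈ F, f s * e (h * t * s)
      = ∑ s ∈ F, ∑' t, g t * (f s * e (h * t * s)) := by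
        simp only [Finset.mul_sum]
        exact Summable.tsum_finsetSum hsum₁
    _ = ∑ s ∈ F, ∑' u, g (u * s⁻¹) * (f s * e (h * u)) := by
        refine Finset.sum_congr rfl fun s _ => ?_
        rw [← (Equiv.mulRight s).tsum_eq fun u => g (u * s⁻¹) * (f s * e (h * u))]
        simp [mul_assoc]
    _ = ∑' u, ∑ s ∈ F, g (u * s⁻¹) * (f s * e (h * u)) := (Summable.tsum_finsetSum hsum₂).symm
    _ = ∑' u, if u = 1 then e (h * u) else 0 := by
        refine tsum_congr fun u => ?_
        have := hgf u
        rw [← finsum_comp_equiv ((Equiv.inv Γ).trans (Equiv.mulLeft u)),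
          finsum_eq_sum_of_support_subset (s := F) _
            fun s hs => hF (by simpa using right_ne_zero_of_mul hs)] at this
        simp only [Equiv.trans_apply, Equiv.inv_apply, Equiv.coe_mulLeft, mul_inv_rev, inv_inv,
          inv_mul_cancel_right] at this
        simp only [← mul_assoc, ← Finset.sum_mul, this, ite_mul, one_mul, zero_mul]
    _ = e h := by rw [tsum_ite_eq, mul_one]

end Convolution

section UnitCircle

theorem AddCircle.exists_coe_eq_abs_eq_norm (a : AddCircle (1 : ℝ)) :
    ∃ r : ℝ, (r : AddCircle (1 : ℝ)) = a ∧ |r| = ‖a‖ := by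
  induction a using QuotientAddGroup.induction_on with
  | H r =>
    refine ⟨r - round r, ?_, by simp [AddCircle.norm_eq]⟩
    rw [AddCircle.coe_sub, sub_eq_self, AddCircle.coe_eq_zero_iff]
    exact ⟨round r, by simp⟩

theorem AddCircle.eq_zero_of_coe_eq_zero_of_abs_lt_one {r : ℝ}
    (hr : (r : AddCircle (1 : ℝ)) = 0) (hlt : |r| < 1) : r = 0 := by
  obtain ⟨n, rfl⟩ := (AddCircle.coe_eq_zero_iff (1 : ℝ)).mp hr
  simp only [zsmul_eq_mul, mul_one] at hlt ⊢
  rw [← Int.cast_abs, ← Int.cast_one, Int.cast_lt, Int.abs_lt_one_iff] at hlt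
  rw [hlt, Int.cast_zero]

theorem AddCircle.coe_sum_intCast_mul {ι : Type*} (F : Finset ι) (n : ι → ℤ) (z : ι → ℝ) :
    ((∑ s ∈ F, (n s : ℝ) * z s : ℝ) : AddCircle (1 : ℝ)) =
      ∑ s ∈ F, n s • (z s : AddCircle (1 : ℝ)) := by
  simp only [← zsmul_eq_mul, ← AddCircle.coe_zsmul]
  exact map_sum (QuotientAddGroup.mk' _) _ _

end UnitCircle

section PrincipalAction

variable {Γ : Type*} [Group Γ]

theorem isClosed_setOf_sum_zsmul_eq_zero (f : Γ → ℤ) (F : Finset Γ) :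
    IsClosed {x : Γ → AddCircle (1 : ℝ) | ∀ h, ∑ s ∈ F, f s • x (h * s) = 0} := by
  simp only [Set.ofPred_forall]
  exact isClosed_iInter fun h => isClosed_eq (by fun_prop) continuous_const

open Classical in
/-- Two points of the principal action that are uniformly close in every coordinate agree. -/
theorem eq_of_sum_zsmul_eq_zero_of_dist_le {f : Γ → ℤ} {g : Γ → ℝ} {F : Finset Γ}
    (hF : Function.support (fun s => (f s : ℝ)) ⊆ F) (hg : Summable fun s => |g s|)
    (hgf : ∀ u, ∑ᶠ h, g h * (f (h⁻¹ * u) : ℝ) = if u = 1 then 1 else 0)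
    {x y : Γ → AddCircle (1 : ℝ)} (hx : ∀ h, ∑ s ∈ F, f s • x (h * s) = 0)
    (hy : ∀ h, ∑ s ∈ F, f s • y (h * s) = 0) {η : ℝ}
    (hη : (∑ s ∈ F, |(f s : ℝ)|) * η < 1) (hxy : ∀ h, dist (x h) (y h) ≤ η) : x = y := by
  choose z hz hz' using fun h => AddCircle.exists_coe_eq_abs_eq_norm (x h - y h)
  have hzη : ∀ h, |z h| ≤ η := fun h => by rw [hz' h, ← dist_eq_norm]; exact hxy h
  have hfz : ∀ h, ∑ s ∈ F, (f s : ℝ) * z (h * s) = 0 := fun h => by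
    refine AddCircle.eq_zero_of_coe_eq_zero_of_abs_lt_one ?_ (lt_of_le_of_lt ?_ hη)
    · rw [AddCircle.coe_sum_intCast_mul]
      simp [hz, zsmul_sub, hx, hy]
    · rw [Finset.sum_mul]
      refine (Finset.abs_sum_le_sum_abs _ _).trans (Finset.sum_le_sum fun s _ => ?_)
      rw [abs_mul]
      exact mul_le_mul_of_nonneg_left (hzη _) (abs_nonneg _)
  funext h
  have h0 := tsum_mul_sum_mul_eq_of_finsum_eq hF hg hgf hzη h
  simp only [hfz, mul_zero, tsum_zero] at h0
  rw [← sub_eq_zero, ← hz h, ← h0, AddCircle.coe_zero]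

open Classical in
/-- An approximate solution of the defining equations lies near an exact one. -/
theorem exists_sum_zsmul_eq_zero_dist_le {f : Γ → ℤ} {g : Γ → ℝ} {F : Finset Γ}
    (hF : Function.support (fun s => (f s : ℝ)) ⊆ F) (hg : Summable fun s => |g s|)
    (hfg : ∀ u, ∑ᶠ h, (f h : ℝ) * g (h⁻¹ * u) = if u = 1 then 1 else 0)
    {x : Γ → AddCircle (1 : ℝ)} {C : ℝ} (hx : ∀ h, ‖∑ s ∈ F, f s • x (h * s)‖ ≤ C) :
    ∃ y : Γ → AddCircle (1 : ℝ), (∀ h, ∑ s ∈ F, f s • y (h * s) = 0) ∧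
      ∀ h, dist (y h) (x h) ≤ (∑' s, |g s|) * C := by
  choose z hz _ using fun h => AddCircle.exists_coe_eq_abs_eq_norm (x h)
  choose e he he' using fun h => AddCircle.exists_coe_eq_abs_eq_norm (∑ s ∈ F, f s • x (h * s))
  have heC : ∀ h, |e h| ≤ C := fun h => (he' h).trans_le (hx h)
  refine ⟨fun h => ((z h - ∑' t, g t * e (h * t) : ℝ) : AddCircle (1 : ℝ)), fun h => ?_,
    fun h => ?_⟩
  · rw [← AddCircle.coe_sum_intCast_mul F f fun s => z (h * s) - ∑' t, g t * e (h * s * t)]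
    simp only [mul_sub, Finset.sum_sub_distrib]
    rw [sum_mul_tsum_mul_eq_of_finsum_eq hF hg hfg heC, AddCircle.coe_sub,
      AddCircle.coe_sum_intCast_mul]
    simp only [hz, he, sub_self]
  · beta_reduce
    rw [AddCircle.coe_sub, hz, dist_eq_norm, sub_sub_cancel_left, norm_neg]
    exact (QuotientAddGroup.norm_mk_le_norm).trans (abs_tsum_mul_le hg fun t => heC _)

end PrincipalAction


open Classical in
theorem principal_algebraic_action_expansive_pot
    {Γ : Type*} [Group Γ] [Countable Γ]
    -- `f ∈ ℤΓ`, finitely supported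
    (f : Γ → ℤ) (hf : (Function.support f).Finite)
    -- `f` is invertible in `ℓ¹(Γ)`, with inverse `g`
    (g : Γ → ℝ) (hg : Summable fun s : Γ => |g s|)
    (hfg : ∀ u : Γ, (∑ᶠ h : Γ, (f h : ℝ) * g (h⁻¹ * u)) = if u = 1 then (1 : ℝ) else 0)
    (hgf : ∀ u : Γ, (∑ᶠ h : Γ, g h * (f (h⁻¹ * u) : ℝ)) = if u = 1 then (1 : ℝ) else 0)
    -- the principal algebraic action `X_f`
    (Xf : Set (Γ → AddCircle (1 : ℝ)))
    (hXf : Xf = {x | ∀ h : Γ, (∑ᶠ s : Γ, f s • x (h * s)) = 0})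
    -- `X_f` is invariant under the shift `(γ · x)(h) = x (γ⁻¹ h)`
    (hshift : ∀ γ : Γ, ∀ x ∈ Xf, (fun h : Γ => x (γ⁻¹ * h)) ∈ Xf)
    -- an arbitrary metric on `X_f` compatible with the product topology
    (dX : MetricSpace ↥Xf)
    (hdX : dX.toUniformSpace.toTopologicalSpace = (inferInstance : TopologicalSpace ↥Xf)) :
    -- the shift action on `X_f` is expansive ...
    (∃ c : ℝ, 0 < c ∧ ∀ x y : ↥Xf,
      (∀ γ : Γ, dX.dist ⟨fun h : Γ => (x : Γ → AddCircle (1 : ℝ)) (γ⁻¹ * h), hshift γ x.1 x.2⟩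
        ⟨fun h : Γ => (y : Γ → AddCircle (1 : ℝ)) (γ⁻¹ * h), hshift γ y.1 y.2⟩ ≤ c) →
      x = y) ∧
    -- ... and satisfies the pseudo-orbit tracing property
    (∀ ε : ℝ, 0 < ε → ∃ (S : Finset Γ) (δ : ℝ), 0 < δ ∧
      ∀ o : Γ → ↥Xf,
        (∀ s ∈ S, ∀ u : Γ,
          dX.dist ⟨fun h : Γ => (o u : Γ → AddCircle (1 : ℝ)) (s⁻¹ * h),
            hshift s (o u).1 (o u).2⟩ (o (s * u)) < δ) →
        ∃ y : ↥Xf, ∀ u : Γ,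
          dX.dist ⟨fun h : Γ => (y : Γ → AddCircle (1 : ℝ)) (u⁻¹ * h),
            hshift u y.1 y.2⟩ (o u) < ε) := by
  have hF : Function.support (fun s => (f s : ℝ)) ⊆ hf.toFinset := fun s hs => by
    simpa using hs
  have hXF : Xf = {x | ∀ h : Γ, ∑ s ∈ hf.toFinset, f s • x (h * s) = 0} := by
    rw [hXf]
    ext x
    refine forall_congr' fun h => ?_
    rw [finsum_eq_sum_of_support_subset (s := hf.toFinset) _ fun s hs => by
      have : f s ≠ 0 := fun h0 => hs (by simp [h0])
      simpa using this]
  clear hXf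
  generalize hf.toFinset = F at hF hXF
  have hmem : ∀ x : Xf, ∀ h : Γ, ∑ s ∈ F, f s • x.1 (h * s) = 0 := fun x =>
    hXF.subset x.2
  have hcpt : IsCompact Xf := by
    rw [hXF]
    exact (isClosed_setOf_sum_zsmul_eq_zero f F).isCompact
  set A : ℝ := ∑ s ∈ F, |(f s : ℝ)| with hA
  set B : ℝ := ∑' s, |g s| with hB
  have hA0 : 0 ≤ A := Finset.sum_nonneg fun s _ => abs_nonneg _
  have hB0 : 0 ≤ B := tsum_nonneg fun s => abs_nonneg _
  refine ⟨?_, fun ε hε => ?_⟩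
  · obtain ⟨δ, hδ, hclose⟩ := exists_forall_dist_apply_lt_of_isCompact hcpt dX hdX 1
      (η := 1 / (A + 1)) (by positivity)
    refine ⟨δ / 2, half_pos hδ, fun x y hxy => Subtype.ext ?_⟩
    refine eq_of_sum_zsmul_eq_zero_of_dist_le hF hg hgf (hmem x) (hmem y) (η := 1 / (A + 1))
      ?_ fun h => ?_
    · rw [← hA, mul_one_div, div_lt_one (by positivity)]
      exact lt_add_one A
    · simpa using (hclose _ _ ((hxy h⁻¹).trans_lt (half_lt_self hδ))).le
  · obtain ⟨I, hI, η, hη, hclose⟩ := exists_finite_forall_dist_lt_of_isCompact hcpt dX hdX hε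
    obtain ⟨δ, hδ, hclose'⟩ := exists_forall_dist_apply_lt_of_isCompact hcpt dX hdX 1
      (η := η / (B * A + 2)) (by positivity)
    refine ⟨F.image (·⁻¹) ∪ hI.toFinset.image (·⁻¹), δ, hδ, fun o ho => ?_⟩
    have hnear : ∀ t : Γ, t ∈ F ∨ t ∈ I → ∀ u : Γ,
        dist ((o u).1 t) ((o (t⁻¹ * u)).1 1) ≤ η / (B * A + 2) := fun t ht u => by
      have hS : t⁻¹ ∈ F.image (·⁻¹) ∪ hI.toFinset.image (·⁻¹) := by simpa using ht
      simpa using (hclose' _ _ (ho t⁻¹ hS u)).le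
    obtain ⟨y, hy, hyo⟩ := exists_sum_zsmul_eq_zero_dist_le hF hg hfg
      (x := fun h => (o h⁻¹).1 1) (C := A * (η / (B * A + 2))) fun h => by
        rw [← sub_zero (∑ s ∈ F, _), ← hmem (o h⁻¹) 1, ← Finset.sum_sub_distrib, hA,
          Finset.sum_mul]
        refine (norm_sum_le _ _).trans (Finset.sum_le_sum fun s hs => ?_)
        rw [← zsmul_sub]
        refine (norm_zsmul_le _ _).trans ?_
        rw [Int.norm_eq_abs]
        refine mul_le_mul_of_nonneg_left ?_ (abs_nonneg _)
        rw [← dist_eq_norm, dist_comm]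
        simpa using hnear s (Or.inl hs) h⁻¹
    have hyX : y ∈ Xf := by rwa [hXF]
    refine ⟨⟨y, hyX⟩, fun u => hclose _ _ fun i hi => ?_⟩
    have h₁ := hyo (u⁻¹ * i)
    have h₂ := hnear i (Or.inr hi) u
    rw [mul_inv_rev, inv_inv] at h₁
    rw [dist_comm] at h₂
    calc dist (y (u⁻¹ * i)) ((o u).1 i)
        ≤ B * (A * (η / (B * A + 2))) + η / (B * A + 2) :=
          (dist_triangle _ _ _).trans (add_le_add h₁ h₂)
      _ = η * ((B * A + 1) / (B * A + 2)) := by ring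
      _ < η * 1 := by
          refine mul_lt_mul_of_pos_left ?_ hη
          rw [div_lt_one (by positivity)]
          linarith
      _ = η := mul_one η
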